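/- Let W : ℝ → (0,∞) be a continuous weight with lim_{|x|→∞} x^n/W(x) = 0 for every n ∈ ℕ, and let 𝔪(z) := sup{|P(z)| : P a polynomial with complex coefficients, ‖P‖_{C₀(W)} ≤ 1} be the Hall majorant. Then the polynomials ℂ[z] are dense in C₀(W) if and only if ∫_ℝ log 𝔪(x)/(1+x²) dx = ∞. -/

import Mathlib

open Filter Polynomial MeasureTheory
open scoped ENNReal NNReal

/-- Membership in the weighted space `C₀(W)` for a finite positive weight `W` on `ℝ`:
continuous functions `f : ℝ → ℂ` with `|f(x)|/W(x) → 0` as `|x| → ∞`. -/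
def MemC0 (W : ℝ → ℝ) (f : ℝ → ℂ) : Prop :=
  Continuous f ∧ Tendsto (fun x => ‖f x‖ / W x) (cocompact ℝ) (nhds 0)

/-- Density of the polynomials in `C₀(W)` with respect to the seminorm
`‖f‖ = sup_x |f(x)|/W(x)`. -/
def PolysDense (W : ℝ → ℝ) : Prop :=
  ∀ f : ℝ → ℂ, MemC0 W f → ∀ ε : ℝ, 0 < ε →
    ∃ P : Polynomial ℂ, ∀ x : ℝ, ‖f x - P.eval (x : ℂ)‖ ≤ ε * W x

/-- The Hall majorant `𝔪(z) = sup {|P(z)| : ‖P‖_{C₀(W)} ≤ 1}`. -/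
noncomputable def hallMajorant (W : ℝ → ℝ) (z : ℂ) : ℝ≥0∞ :=
  ⨆ P : {P : Polynomial ℂ // ∀ x : ℝ, ‖P.eval (x : ℂ)‖ ≤ W x},
    (‖(P : Polynomial ℂ).eval z‖₊ : ℝ≥0∞)

/-- The density of the angular measure on the circle, transported to the line by the
stereographic projection. -/
noncomputable def cauchyWeight (t : ℝ) : ℝ≥0∞ := ENNReal.ofReal (2 / (1 + t ^ 2))

theorem measurable_cauchyWeight : Measurable cauchyWeight := by
  unfold cauchyWeight
  fun_prop

theorem cauchyWeight_ne_top (t : ℝ) : cauchyWeight t ≠ ⊤ := ENNReal.ofReal_ne_top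

theorem lintegral_circle_eq_lintegral_arctan (g : ℝ → ℝ≥0∞) :
    ∫⁻ θ in Set.Ioc 0 (2 * Real.pi), g θ =
      ∫⁻ t : ℝ, cauchyWeight t * g (Real.pi + 2 * Real.arctan t) := by
  have hderiv (t : ℝ) :
      HasDerivAt (fun t : ℝ => Real.pi + 2 * Real.arctan t) (2 / (1 + t ^ 2)) t := by
    have := ((Real.hasDerivAt_arctan t).const_mul 2).const_add Real.pi
    simpa [div_eq_mul_inv] using this
  have hinj : Function.Injective (fun t : ℝ => Real.pi + 2 * Real.arctan t) := by
    intro a b hab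
    exact Real.arctan_injective (by simpa using hab)
  have himage : (fun t : ℝ => Real.pi + 2 * Real.arctan t) '' Set.univ =
      Set.Ioo 0 (2 * Real.pi) := by
    ext θ
    constructor
    · rintro ⟨t, -, rfl⟩
      have h := Real.arctan_mem_Ioo t
      simp only [Set.mem_Ioo] at h ⊢
      constructor <;> linarith [h.1, h.2]
    · rintro ⟨h0, h1⟩
      refine ⟨Real.tan ((θ - Real.pi) / 2), trivial, ?_⟩
      simp only
      rw [Real.arctan_tan] <;> linarith
  have h := lintegral_image_eq_lintegral_abs_deriv_mul MeasurableSet.univ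
    (fun t _ => (hderiv t).hasDerivWithinAt) hinj.injOn g
  rw [himage, Measure.restrict_univ] at h
  rw [restrict_Ioo_eq_restrict_Ioc.symm, h]
  refine lintegral_congr fun t => ?_
  rw [cauchyWeight, abs_of_pos (by positivity)]

theorem circleMap_pi_add_two_mul_arctan (r t : ℝ) :
    circleMap 0 r (Real.pi + 2 * Real.arctan t) =
      -(r * (1 + Complex.I * t) / (1 - Complex.I * t)) := by
  have hne : (1 - Complex.I * t : ℂ) ≠ 0 := by
    intro h
    have := congrArg Complex.re h
    simp at this
  have hexp : Complex.exp (Real.arctan t * Complex.I) =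
      (1 + Complex.I * t) / (Real.sqrt (1 + t ^ 2) : ℝ) := by
    rw [Complex.exp_mul_I, ← Complex.ofReal_cos, ← Complex.ofReal_sin, Real.cos_arctan,
      Real.sin_arctan]
    push_cast
    ring
  have hs : ((Real.sqrt (1 + t ^ 2) : ℝ) : ℂ) ^ 2 = 1 + t ^ 2 := by
    norm_cast
    rw [Real.sq_sqrt (by positivity)]
  have hs0 : (1 + t ^ 2 : ℂ) ≠ 0 := by
    norm_cast
    positivity
  have h2 : Complex.exp ((Real.pi + 2 * Real.arctan t : ℝ) * Complex.I) =
      -(Complex.exp (Real.arctan t * Complex.I)) ^ 2 := by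
    rw [← Complex.exp_nat_mul]
    push_cast
    rw [add_mul, Complex.exp_add, Complex.exp_pi_mul_I]
    ring_nf
  rw [circleMap, h2, hexp, div_pow, hs, zero_add, mul_neg, neg_inj, ← mul_div_assoc,
    div_eq_div_iff hs0 hne]
  ring_nf
  simp only [show Complex.I ^ 3 = -Complex.I by rw [pow_succ, Complex.I_sq]; ring, Complex.I_sq]
  ring

theorem ofReal_integral_le_lintegral_ofReal {α : Type*} [MeasurableSpace α] {μ : Measure α}
    {f : α → ℝ} (hf : Integrable f μ) :
    ENNReal.ofReal (∫ a, f a ∂μ) ≤ ∫⁻ a, ENNReal.ofReal (f a) ∂μ := by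
  rw [integral_eq_lintegral_pos_part_sub_lintegral_neg_part hf]
  refine (ENNReal.ofReal_le_ofReal (sub_le_self _ ENNReal.toReal_nonneg)).trans ?_
  exact ENNReal.ofReal_toReal_le

/-- Jensen's inequality on the unit disc, with poles allowed on the boundary circle. -/
theorem log_norm_le_circleAverage {f : ℂ → ℂ} (hf : MeromorphicOn f (Metric.closedBall 0 1))
    (hfa : ∀ z ∈ Metric.ball (0 : ℂ) 1, AnalyticAt ℂ f z) (hf0 : f 0 ≠ 0) :
    Real.log ‖f 0‖ ≤ Real.circleAverage (fun z => Real.log ‖f z‖) 0 1 := by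
  have h0 := hfa 0 (by simp)
  have hf' : MeromorphicOn f (Metric.closedBall 0 |1|) := by simpa using hf
  rw [hf'.circleAverage_log_norm one_ne_zero,
    h0.meromorphicTrailingCoeffAt_of_ne_zero hf0]
  simp only [Real.log_one, mul_zero, add_zero, zero_sub, norm_neg, one_mul]
  refine le_add_of_nonneg_left (finsum_nonneg fun u => ?_)
  by_cases hu : u ∈ Metric.closedBall (0 : ℂ) |1|
  · by_cases hu' : ‖u‖ < 1
    · refine mul_nonneg ?_ ?_
      · rw [MeromorphicOn.divisor_apply hf' hu]
        have := (hfa u (by simpa using hu')).meromorphicOrderAt_nonneg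
        exact_mod_cast (WithTop.untop₀_nonneg).2 (by simpa using this)
      · rw [Real.log_inv, neg_nonneg]
        exact Real.log_nonpos (norm_nonneg _) hu'.le
    · have : ‖u‖ = 1 := le_antisymm (by simpa using hu) (not_lt.1 hu')
      simp [this]
  · simp [Function.locallyFinsuppWithin.apply_eq_zero_of_notMem _ hu]

theorem ofReal_log_norm_le_lintegral_arctan {f : ℂ → ℂ}
    (hf : MeromorphicOn f (Metric.closedBall 0 1))
    (hfa : ∀ z ∈ Metric.ball (0 : ℂ) 1, AnalyticAt ℂ f z) :
    ENNReal.ofReal (2 * Real.pi * Real.log ‖f 0‖) ≤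
      ∫⁻ t : ℝ, cauchyWeight t *
        ENNReal.ofReal (Real.log ‖f (circleMap 0 1 (Real.pi + 2 * Real.arctan t))‖) := by
  by_cases hf0 : f 0 = 0
  · simp [hf0]
  rw [← lintegral_circle_eq_lintegral_arctan
    (fun θ => ENNReal.ofReal (Real.log ‖f (circleMap 0 1 θ)‖))]
  have hint : CircleIntegrable (fun z => Real.log ‖f z‖) 0 1 :=
    MeromorphicOn.circleIntegrable_log_norm
      (fun z hz => hf z (by simpa using Metric.sphere_subset_closedBall hz))
  have hpi : (0 : ℝ) ≤ 2 * Real.pi := by positivity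
  have hint' := (intervalIntegrable_iff_integrableOn_Ioc_of_le hpi).1 hint
  refine le_trans ?_ (ofReal_integral_le_lintegral_ofReal hint')
  refine ENNReal.ofReal_le_ofReal ?_
  have := log_norm_le_circleAverage hf hfa hf0
  rw [Real.circleAverage_def, intervalIntegral.integral_of_le hpi, smul_eq_mul,
    ← div_eq_inv_mul, le_div_iff₀ (by positivity)] at this
  linarith

theorem ofReal_log_norm_eval_I_le (Q : Polynomial ℂ) :
    ENNReal.ofReal (2 * Real.pi * Real.log ‖Q.eval Complex.I‖) ≤
      ∫⁻ t : ℝ, cauchyWeight t *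
        ENNReal.ofReal (Real.log ‖Q.eval (t : ℂ)‖) := by
  have han (w : ℂ) (hw : w ≠ 1) :
      AnalyticAt ℂ (fun w => Q.eval (Complex.I * (1 + w) / (1 - w))) w := by
    have : AnalyticAt ℂ (fun w : ℂ => Complex.I * (1 + w) / (1 - w)) w := by
      refine AnalyticAt.div (by fun_prop) (by fun_prop) (sub_ne_zero.2 hw.symm)
    exact this.aeval_polynomial Q
  have hmer : Meromorphic (fun w => Q.eval (Complex.I * (1 + w) / (1 - w))) := by
    have : Meromorphic (fun w : ℂ => Complex.I * (1 + w) / (1 - w)) := fun w =>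
      (AnalyticAt.meromorphicAt (by fun_prop)).div (AnalyticAt.meromorphicAt (by fun_prop))
    simp only [Polynomial.eval_eq_sum_range]
    fun_prop
  have h := ofReal_log_norm_le_lintegral_arctan (fun z _ => hmer z)
    (fun z hz => han z (by rintro rfl; simp at hz))
  simp only [add_zero, sub_zero, div_one, mul_one] at h
  refine h.trans (le_of_eq (lintegral_congr fun t => ?_))
  congr 5
  rw [circleMap_pi_add_two_mul_arctan]
  have hne : (1 - Complex.I * t : ℂ) ≠ 0 := by
    intro h
    have := congrArg Complex.re h
    simp at this
  have h1 : (1 - -((1 : ℝ) * (1 + Complex.I * t) / (1 - Complex.I * t)) : ℂ) =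
    2 / (1 - Complex.I * t) := by
    field_simp; push_cast; ring
  rw [h1]
  field_simp
  push_cast
  ring_nf
  simp

theorem one_lt_im_two_mul_I_div {v : ℂ} (hv : ‖v‖ < 1) :
    1 < (2 * Complex.I / (1 - v)).im := by
  have h1 : v.re < 1 := (Complex.re_le_norm v).trans_lt hv
  have h2 : v.re ^ 2 + v.im ^ 2 < 1 := by
    have := Complex.sq_norm v
    rw [Complex.normSq_apply] at this
    nlinarith [norm_nonneg v]
  have h3 : (0 : ℝ) < (1 - v.re) * (1 - v.re) + v.im * v.im := by
    nlinarith [mul_pos (sub_pos.2 h1) (sub_pos.2 h1), mul_self_nonneg v.im]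
  rw [Complex.div_im, Complex.normSq_apply]
  simp only [Complex.mul_re, Complex.mul_im, Complex.sub_re, Complex.sub_im, Complex.one_re,
    Complex.one_im, Complex.re_ofNat, Complex.im_ofNat, Complex.I_re, Complex.I_im]
  rw [← sub_div, lt_div_iff₀ (by simpa using h3)]
  nlinarith

theorem lintegral_neg_log_norm_le {f : ℂ → ℂ}
    (hfa : AnalyticOnNhd ℂ f (Metric.closedBall 0 1))
    (hle : ∀ z ∈ Metric.closedBall (0 : ℂ) 1, ‖f z‖ ≤ 1) (hf0 : f 0 ≠ 0) :
    ∫⁻ t : ℝ, cauchyWeight t *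
        ENNReal.ofReal (-Real.log ‖f (circleMap 0 1 (Real.pi + 2 * Real.arctan t))‖) ≤
      ENNReal.ofReal (-(2 * Real.pi * Real.log ‖f 0‖)) := by
  rw [← lintegral_circle_eq_lintegral_arctan
    (fun θ => ENNReal.ofReal (-Real.log ‖f (circleMap 0 1 θ)‖))]
  have hint : CircleIntegrable (fun z => Real.log ‖f z‖) 0 1 :=
    MeromorphicOn.circleIntegrable_log_norm
      (fun z hz => (hfa z (by simpa using Metric.sphere_subset_closedBall hz)).meromorphicAt)
  have hpi : (0 : ℝ) ≤ 2 * Real.pi := by positivity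
  have hint' := (intervalIntegrable_iff_integrableOn_Ioc_of_le hpi).1 hint
  have hnn (θ : ℝ) : 0 ≤ -Real.log ‖f (circleMap 0 1 θ)‖ :=
    neg_nonneg.2 (Real.log_nonpos (norm_nonneg _) (hle _ (by simp)))
  rw [← ofReal_integral_eq_lintegral_ofReal
    (f := fun θ => -Real.log ‖f (circleMap 0 1 θ)‖) hint'.neg (ae_of_all _ hnn)]
  refine ENNReal.ofReal_le_ofReal ?_
  have := log_norm_le_circleAverage (fun z hz => (hfa z hz).meromorphicAt)
    (fun z hz => hfa z (Metric.ball_subset_closedBall hz)) hf0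
  rw [Real.circleAverage_def, intervalIntegral.integral_of_le hpi, smul_eq_mul,
    ← div_eq_inv_mul, le_div_iff₀ (by positivity)] at this
  rw [integral_neg]
  linarith

theorem lintegral_neg_log_norm_halfPlane_le {F : ℂ → ℂ} {M : ℝ} (hM : 0 < M)
    (hF : DifferentiableOn ℂ F {z | 0 < z.im}) (hle : ∀ z : ℂ, 1 ≤ z.im → ‖F z‖ ≤ M)
    (hF0 : F (2 * Complex.I) ≠ 0) :
    ∫⁻ t : ℝ, cauchyWeight t *
        ENNReal.ofReal (-Real.log (‖F (t + Complex.I)‖ / M)) ≤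
      ENNReal.ofReal (-(2 * Real.pi * Real.log (‖F (2 * Complex.I)‖ / M))) := by
  have hopen : IsOpen {z : ℂ | 0 < z.im} := isOpen_lt continuous_const Complex.continuous_im
  let G : ℝ → ℂ → ℂ := fun r w => F (2 * Complex.I / (1 - r * w)) / M
  have hmul {r : ℝ} (hr0 : 0 ≤ r) (hr1 : r < 1) {w : ℂ} (hw : w ∈ Metric.closedBall (0 : ℂ) 1) :
      ‖(r * w : ℂ)‖ < 1 := by
    have hw : ‖w‖ ≤ 1 := by simpa using hw
    rw [norm_mul, Complex.norm_real, Real.norm_of_nonneg hr0]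
    nlinarith [norm_nonneg w]
  have hG {r : ℝ} (hr0 : 0 ≤ r) (hr1 : r < 1) :
      ∫⁻ t : ℝ, cauchyWeight t *
        ENNReal.ofReal (-Real.log ‖G r (circleMap 0 1 (Real.pi + 2 * Real.arctan t))‖) ≤
      ENNReal.ofReal (-(2 * Real.pi * Real.log (‖F (2 * Complex.I)‖ / M))) := by
    have h := lintegral_neg_log_norm_le (f := G r) (fun w hw => ?_) (fun w hw => ?_) ?_
    · simpa [G, abs_of_pos hM] using h
    · have h1 := one_lt_im_two_mul_I_div (hmul hr0 hr1 hw)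
      have h2 : AnalyticAt ℂ F (2 * Complex.I / (1 - r * w)) :=
        hF.analyticAt (hopen.mem_nhds (by simp only [Set.mem_ofPred_eq]; linarith))
      have h3 : (1 - r * w : ℂ) ≠ 0 := by
        intro h0
        rw [h0] at h1
        simp at h1
        linarith
      have h4 : AnalyticAt ℂ (fun w : ℂ => 2 * Complex.I / (1 - r * w)) w :=
        AnalyticAt.div (by fun_prop) (by fun_prop) h3
      exact (h2.comp_of_eq h4 rfl).div_const
    · have h1 := one_lt_im_two_mul_I_div (hmul hr0 hr1 hw)
      simp only [G, norm_div, Complex.norm_real, Real.norm_of_nonneg hM.le]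
      exact div_le_one_of_le₀ (hle _ h1.le) hM.le
    · simpa [G, hM.ne'] using hF0
  let r : ℕ → ℝ := fun n => n / (n + 1 : ℝ)
  have hr0 (n : ℕ) : 0 ≤ r n := by positivity
  have hr1 (n : ℕ) : r n < 1 := by
    simp only [r]
    rw [div_lt_one (by positivity)]
    linarith
  have hrlim : Tendsto r atTop (nhds 1) := tendsto_natCast_div_add_atTop 1
  have hcont (n : ℕ) : Continuous fun t : ℝ =>
      G (r n) (circleMap 0 1 (Real.pi + 2 * Real.arctan t)) := by
    refine Continuous.div_const ?_ _
    refine hF.continuousOn.comp_continuous ?_ (fun t => ?_)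
    · refine Continuous.div continuous_const ?_ (fun t h0 => ?_)
      · have := Real.continuous_arctan
        fun_prop
      · have h1 := one_lt_im_two_mul_I_div
          (hmul (hr0 n) (hr1 n) (w := circleMap 0 1 (Real.pi + 2 * Real.arctan t)) (by simp))
        rw [h0] at h1
        simp at h1
        linarith
    · have h1 := one_lt_im_two_mul_I_div
          (hmul (hr0 n) (hr1 n) (w := circleMap 0 1 (Real.pi + 2 * Real.arctan t)) (by simp))
      simp only [Set.mem_ofPred_eq]
      linarith
  have hmeas (n : ℕ) : Measurable fun t : ℝ => cauchyWeight t *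
      ENNReal.ofReal (-Real.log ‖G (r n) (circleMap 0 1 (Real.pi + 2 * Real.arctan t))‖) := by
    exact measurable_cauchyWeight.mul <| ENNReal.measurable_ofReal.comp
      (Real.measurable_log.comp (hcont n).norm.measurable).neg
  refine le_trans ?_ (liminf_le_of_le (f := atTop) (u := fun n =>
    ∫⁻ t : ℝ, cauchyWeight t *
      ENNReal.ofReal (-Real.log ‖G (r n) (circleMap 0 1 (Real.pi + 2 * Real.arctan t))‖)) (by isBoundedDefault) (fun b hb => ?_))
  · refine le_trans (lintegral_mono fun t => ?_) (lintegral_liminf_le hmeas)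
    by_cases h0 : F (t + Complex.I) = 0
    · simp [h0]
    have hne : (1 - Complex.I * t : ℂ) ≠ 0 := by
      intro h
      have := congrArg Complex.re h
      simp at this
    have hpt : 2 * Complex.I / (1 - (1 : ℝ) * circleMap 0 1 (Real.pi + 2 * Real.arctan t)) =
        t + Complex.I := by
      rw [circleMap_pi_add_two_mul_arctan]
      have h1 : (1 - (1 : ℝ) * -((1 : ℝ) * (1 + Complex.I * t) / (1 - Complex.I * t)) : ℂ) =
          2 / (1 - Complex.I * t) := by
        field_simp; push_cast; ring
      rw [h1]
      field_simp
      ring_nf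
      simp
    have hden : (1 - (1 : ℝ) * circleMap 0 1 (Real.pi + 2 * Real.arctan t) : ℂ) ≠ 0 := by
      intro h
      rw [h] at hpt
      have := congrArg Complex.im hpt
      simp at this
    have hFt : ContinuousAt F (t + Complex.I) :=
      hF.continuousOn.continuousAt (hopen.mem_nhds (by simp))
    have hcr : ContinuousAt
        (fun r : ℝ => G r (circleMap 0 1 (Real.pi + 2 * Real.arctan t))) 1 := by
      refine ContinuousAt.div_const ?_ _
      refine ContinuousAt.comp' (by rwa [hpt]) ?_
      exact ContinuousAt.div (by fun_prop) (by fun_prop) hden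
    have hval : G 1 (circleMap 0 1 (Real.pi + 2 * Real.arctan t)) = F (t + Complex.I) / M := by
      simp only [G]
      rw [hpt]
    have hlim := hcr.tendsto.comp hrlim
    rw [hval] at hlim
    have hne' : ‖F (t + Complex.I) / M‖ ≠ 0 := by
      simpa [hM.ne'] using h0
    have hlim2 := ENNReal.Tendsto.const_mul (a := cauchyWeight t)
      (ENNReal.tendsto_ofReal ((hlim.norm.log hne').neg)) (Or.inr (cauchyWeight_ne_top t))
    have heq := hlim2.liminf_eq
    simp only [Function.comp_def] at heq
    rw [heq]
    simp [abs_of_pos hM]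
  · obtain ⟨n, hn⟩ := hb.exists
    exact hn.trans (hG (hr0 n) (hr1 n))

theorem lintegral_cauchyWeight_ne_top : ∫⁻ t, cauchyWeight t ≠ ⊤ := by
  have h := lintegral_circle_eq_lintegral_arctan (fun _ => 1)
  simp only [mul_one] at h
  rw [← h]
  simp [ENNReal.mul_eq_top]

theorem cauchyWeight_mul_le (x s : ℝ) :
    cauchyWeight x * cauchyWeight (x - s) ≤
      (2 * cauchyWeight x + 2 * cauchyWeight (x - s)) * cauchyWeight s := by
  unfold cauchyWeight
  rw [← ENNReal.ofReal_mul (by positivity), ← ENNReal.ofReal_ofNat,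
    ← ENNReal.ofReal_mul (by positivity), ← ENNReal.ofReal_mul (by positivity),
    ← ENNReal.ofReal_add (by positivity) (by positivity), ← ENNReal.ofReal_mul (by positivity)]
  refine ENNReal.ofReal_le_ofReal ?_
  have h1 : 0 < 1 + x ^ 2 := by positivity
  have h2 : 0 < 1 + (x - s) ^ 2 := by positivity
  have h3 : 0 < 1 + s ^ 2 := by positivity
  have : (2 * (2 / (1 + x ^ 2)) + 2 * (2 / (1 + (x - s) ^ 2))) * (2 / (1 + s ^ 2)) =
      4 * (2 * (1 + (x - s) ^ 2) + 2 * (1 + x ^ 2)) /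
        ((1 + x ^ 2) * (1 + (x - s) ^ 2) * (1 + s ^ 2)) := by
    field_simp
    ring
  rw [this, div_mul_div_comm, div_le_div_iff₀ (by positivity) (by positivity)]
  have h4 : 1 + s ^ 2 ≤ 2 * (1 + (x - s) ^ 2) + 2 * (1 + x ^ 2) := by
    nlinarith [sq_nonneg (2 * x - s)]
  nlinarith [mul_le_mul_of_nonneg_left h4 (mul_pos h1 h2).le]

/-- Convolution with the Cauchy weight is bounded on functions integrable against it. -/
theorem lintegral_cauchyWeight_conv_le {h : ℝ → ℝ≥0∞} (hh : Measurable h) :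
    ∫⁻ x, cauchyWeight x * ∫⁻ t, cauchyWeight t * h (x - t) ≤
      4 * (∫⁻ t, cauchyWeight t) * ∫⁻ s, cauchyWeight s * h s := by
  have hK := measurable_cauchyWeight
  calc ∫⁻ x, cauchyWeight x * ∫⁻ t, cauchyWeight t * h (x - t)
      = ∫⁻ x, ∫⁻ s, cauchyWeight x * (cauchyWeight (x - s) * h s) := by
        refine lintegral_congr fun x => ?_
        rw [lintegral_const_mul _ (by fun_prop),
          ← lintegral_sub_left_eq_self (fun s => cauchyWeight (x - s) * h s) x]
        simp
    _ ≤ ∫⁻ x, ∫⁻ s, (2 * cauchyWeight x + 2 * cauchyWeight (x - s)) *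
          (cauchyWeight s * h s) := by
        refine lintegral_mono fun x => lintegral_mono fun s => ?_
        simp only [← mul_assoc]
        exact mul_le_mul' (cauchyWeight_mul_le x s) le_rfl
    _ = ∫⁻ s, ∫⁻ x, (2 * cauchyWeight x + 2 * cauchyWeight (x - s)) *
          (cauchyWeight s * h s) := lintegral_lintegral_swap (by fun_prop)
    _ = ∫⁻ s, (4 * ∫⁻ t, cauchyWeight t) * (cauchyWeight s * h s) := by
        refine lintegral_congr fun s => ?_
        rw [lintegral_mul_const _ (by fun_prop), lintegral_add_left (by fun_prop),
          lintegral_const_mul _ (by fun_prop), lintegral_const_mul _ (by fun_prop),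
          lintegral_sub_right_eq_self cauchyWeight s]
        ring
    _ = _ := lintegral_const_mul _ (by fun_prop)

theorem lintegral_cauchyWeight_comp_le {h : ℝ → ℝ≥0∞} {x b : ℝ} (hx : |x| ≤ 1 / 2)
    (hb : 1 / 2 ≤ b) (hb' : b ≤ 3 / 2) :
    ∫⁻ t, cauchyWeight t * h (x - b * t) ≤ 9 * ∫⁻ s, cauchyWeight s * h s := by
  have hb0 : 0 < b := by linarith
  have himage : (fun t : ℝ => x - b * t) '' Set.univ = Set.univ :=
    Set.image_univ_of_surjective fun s => ⟨(x - s) / b, by field_simp; ring⟩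
  have key := lintegral_image_eq_lintegral_abs_deriv_mul MeasurableSet.univ
    (fun t _ => (((hasDerivAt_id t).const_mul b).const_sub x).hasDerivWithinAt)
    (fun t _ u _ htu => by simpa [hb0.ne'] using htu) (fun s => cauchyWeight s * h s)
  simp only [id, himage, Measure.restrict_univ] at key
  rw [key, ← lintegral_const_mul' _ _ (by simp)]
  refine lintegral_mono fun t => ?_
  simp only [← mul_assoc]
  gcongr
  unfold cauchyWeight
  rw [← ENNReal.ofReal_ofNat, ← ENNReal.ofReal_mul (by positivity),
    ← ENNReal.ofReal_mul (by positivity)]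
  refine ENNReal.ofReal_le_ofReal ?_
  rw [mul_one, abs_neg, abs_of_pos hb0, ← mul_div_assoc,
    div_le_div_iff₀ (by positivity) (by positivity)]
  have hx2 : x ^ 2 ≤ 1 / 4 := by nlinarith [abs_le.1 hx]
  have h1 : 1 + (x - b * t) ^ 2 ≤ 3 / 2 + 2 * b ^ 2 * t ^ 2 := by
    nlinarith [sq_nonneg (x + b * t)]
  have h2 : b ^ 2 * t ^ 2 ≤ 3 / 2 * b * t ^ 2 := by
    nlinarith [mul_nonneg hb0.le (sq_nonneg t)]
  nlinarith [mul_nonneg hb0.le (sq_nonneg t)]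

open BoundedContinuousFunction in
/-- The bounded continuous functions `P / W` with `P` a polynomial. -/
def weightedPolynomials (W : ℝ → ℝ) : Submodule ℂ (ℝ →ᵇ ℂ) where
  carrier := {v | ∃ P : Polynomial ℂ, ∀ x : ℝ, v x * W x = P.eval (x : ℂ)}
  add_mem' := by
    rintro v w ⟨P, hP⟩ ⟨Q, hQ⟩
    exact ⟨P + Q, fun x => by simp [add_mul, hP, hQ]⟩
  zero_mem' := ⟨0, fun x => by simp⟩
  smul_mem' := by
    rintro c v ⟨P, hP⟩
    exact ⟨Polynomial.C c * P, fun x => by simp [mul_assoc, hP]⟩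

theorem ofReal_sub_ne_zero {z : ℂ} (hz : z.im ≠ 0) (t : ℝ) : (t - z : ℂ) ≠ 0 := by
  intro h
  have := congrArg Complex.im h
  simp at this
  exact hz this

/-- The Cauchy kernel `t ↦ (t - z)⁻¹` as a bounded continuous function. -/
noncomputable def cauchyKernel (z : ℂ) (hz : z.im ≠ 0) : BoundedContinuousFunction ℝ ℂ :=
  BoundedContinuousFunction.ofNormedAddCommGroup (fun t : ℝ => ((t : ℂ) - z)⁻¹)
    (Continuous.inv₀ (by fun_prop) (ofReal_sub_ne_zero hz)) |z.im|⁻¹ (fun t => by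
      rw [norm_inv]
      refine inv_anti₀ (abs_pos.2 hz) ?_
      simpa using Complex.abs_im_le_norm ((t : ℂ) - z))

theorem cauchyKernel_apply (z : ℂ) (hz : z.im ≠ 0) (t : ℝ) :
    cauchyKernel z hz t = ((t : ℂ) - z)⁻¹ := rfl

theorem norm_cauchyKernel_le (z : ℂ) (hz : z.im ≠ 0) : ‖cauchyKernel z hz‖ ≤ |z.im|⁻¹ :=
  BoundedContinuousFunction.norm_ofNormedAddCommGroup_le _ (by positivity) _

theorem cauchyKernel_mul_sub_mem {W : ℝ → ℝ} {v v₀ : BoundedContinuousFunction ℝ ℂ}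
    {P : Polynomial ℂ} (hv : ∀ x : ℝ, v x * W x = P.eval (x : ℂ)) (hv₀ : ∀ x, v₀ x * W x = 1)
    (z : ℂ) (hz : z.im ≠ 0) :
    cauchyKernel z hz * v - P.eval z • (cauchyKernel z hz * v₀) ∈ weightedPolynomials W := by
  refine ⟨P /ₘ (X - C z), fun x => ?_⟩
  have h := congrArg (Polynomial.eval (x : ℂ)) (modByMonic_add_div P (X - C z))
  rw [modByMonic_X_sub_C_eq_C_eval] at h
  simp only [eval_add, eval_C, eval_mul, eval_sub, eval_X] at h
  have hne := ofReal_sub_ne_zero hz x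
  simp only [BoundedContinuousFunction.coe_sub, BoundedContinuousFunction.coe_mul,
    BoundedContinuousFunction.coe_smul, Pi.sub_apply, Pi.mul_apply, cauchyKernel_apply,
    smul_eq_mul]
  have h1 : ((x - z : ℂ)⁻¹ * v x - P.eval z * ((x - z : ℂ)⁻¹ * v₀ x)) * W x =
      (x - z : ℂ)⁻¹ * (v x * W x - P.eval z * (v₀ x * W x)) := by ring
  rw [h1, hv, hv₀, ← h]
  field_simp
  ring

theorem cauchyKernel_mul_mem_closure {W : ℝ → ℝ} {v₀ : BoundedContinuousFunction ℝ ℂ}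
    (hv₀ : ∀ x, v₀ x * W x = 1) (z : ℂ) (hz : z.im ≠ 0)
    (hmem : cauchyKernel z hz * v₀ ∈ (weightedPolynomials W).topologicalClosure)
    {v : BoundedContinuousFunction ℝ ℂ} (hv : v ∈ (weightedPolynomials W).topologicalClosure) :
    cauchyKernel z hz * v ∈ (weightedPolynomials W).topologicalClosure := by
  refine closure_minimal (t := {v | cauchyKernel z hz * v ∈
    (weightedPolynomials W).topologicalClosure}) ?_ ?_ hv
  · rintro v ⟨P, hP⟩
    have h1 := (weightedPolynomials W).le_topologicalClosure
      (cauchyKernel_mul_sub_mem hP hv₀ z hz)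
    have h2 := Submodule.add_mem _ h1 (Submodule.smul_mem _ (P.eval z) hmem)
    simpa using h2
  · exact (weightedPolynomials W).isClosed_topologicalClosure.preimage
      (continuous_const.mul continuous_id)

theorem star_mem_closure_weightedPolynomials {W : ℝ → ℝ} {v : BoundedContinuousFunction ℝ ℂ}
    (hv : v ∈ (weightedPolynomials W).topologicalClosure) :
    star v ∈ (weightedPolynomials W).topologicalClosure := by
  refine map_mem_closure continuous_star hv ?_
  rintro v ⟨P, hP⟩
  refine ⟨P.map (starRingEnd ℂ), fun x => ?_⟩
  have := congrArg (starRingEnd ℂ) (hP x)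
  rw [map_mul, Complex.conj_ofReal] at this
  rw [BoundedContinuousFunction.star_apply, RCLike.star_def, this,
    ← Complex.conj_ofReal x, Polynomial.eval_map_apply, Complex.conj_ofReal]

/-- Restriction of continuous functions on the one-point compactification to the line. -/
noncomputable def restrictToLine (φ : C(OnePoint ℝ, ℂ)) : BoundedContinuousFunction ℝ ℂ :=
  (BoundedContinuousFunction.mkOfCompact φ).compContinuous ⟨_, OnePoint.continuous_coe⟩

theorem restrictToLine_apply (φ : C(OnePoint ℝ, ℂ)) (x : ℝ) :
    restrictToLine φ x = φ (x : OnePoint ℝ) := rfl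

theorem continuous_restrictToLine : Continuous restrictToLine :=
  (BoundedContinuousFunction.continuous_compContinuous _).comp
    (ContinuousMap.isometryEquivBoundedOfCompact (OnePoint ℝ) ℂ).continuous

/-- The functions on the one-point compactification of the line which multiply the closure of
the weighted polynomials into itself. -/
noncomputable def multiplierAlgebra (W : ℝ → ℝ) : StarSubalgebra ℂ C(OnePoint ℝ, ℂ) where
  carrier := {φ | ∀ v ∈ (weightedPolynomials W).topologicalClosure,
    restrictToLine φ * v ∈ (weightedPolynomials W).topologicalClosure}
  mul_mem' := by
    intro φ ψ hφ hψ v hv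
    have : restrictToLine (φ * ψ) * v = restrictToLine φ * (restrictToLine ψ * v) := by
      ext x
      simp [restrictToLine_apply, mul_assoc]
    rw [this]
    exact hφ _ (hψ _ hv)
  add_mem' := by
    intro φ ψ hφ hψ v hv
    have : restrictToLine (φ + ψ) * v = restrictToLine φ * v + restrictToLine ψ * v := by
      ext x
      simp [restrictToLine_apply, add_mul]
    rw [this]
    exact Submodule.add_mem _ (hφ _ hv) (hψ _ hv)
  algebraMap_mem' := by
    intro c v hv
    have : restrictToLine (algebraMap ℂ C(OnePoint ℝ, ℂ) c) * v = c • v := by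
      ext x
      simp [restrictToLine_apply, Algebra.algebraMap_eq_smul_one]
    rw [this]
    exact Submodule.smul_mem _ _ hv
  star_mem' := by
    intro φ hφ v hv
    have : restrictToLine (star φ) * v = star (restrictToLine φ * star v) := by
      ext x
      simp [restrictToLine_apply]
    rw [this]
    exact star_mem_closure_weightedPolynomials
      (hφ _ (star_mem_closure_weightedPolynomials hv))

theorem multiplierAlgebra_eq_top {W : ℝ → ℝ} {v₀ : BoundedContinuousFunction ℝ ℂ}
    (hv₀ : ∀ x, v₀ x * W x = 1) (z : ℂ) (hz : z.im ≠ 0)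
    (hmem : cauchyKernel z hz * v₀ ∈ (weightedPolynomials W).topologicalClosure) :
    multiplierAlgebra W = ⊤ := by
  have hlim : Tendsto (fun t : ℝ => ((t : ℂ) - z)⁻¹) (coclosedCompact ℝ) (nhds 0) := by
    rw [coclosedCompact_eq_cocompact]
    refine tendsto_inv₀_cobounded.comp ?_
    rw [← Metric.cobounded_eq_cocompact, ← tendsto_norm_atTop_iff_cobounded]
    refine tendsto_atTop_mono (fun t => ?_)
      (tendsto_atTop_add_const_right _ (-‖z‖) tendsto_norm_cobounded_atTop)
    have := norm_sub_norm_le (t : ℂ) z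
    rw [Complex.norm_real] at this
    linarith
  let γ : C(OnePoint ℝ, ℂ) := OnePoint.continuousMapMk
    ⟨fun t : ℝ => ((t : ℂ) - z)⁻¹, (cauchyKernel z hz).continuous⟩ 0 hlim
  have hγ : γ ∈ multiplierAlgebra W := fun v hv =>
    cauchyKernel_mul_mem_closure hv₀ z hz hmem hv
  have hsep : (multiplierAlgebra W).SeparatesPoints := by
    intro x y hxy
    refine ⟨γ, ⟨γ, hγ, rfl⟩, fun h => hxy ?_⟩
    induction x using OnePoint.rec with
    | infty =>
      induction y using OnePoint.rec with
      | infty => rfl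
      | coe y => exact absurd h.symm (inv_ne_zero (ofReal_sub_ne_zero hz y))
    | coe x =>
      induction y using OnePoint.rec with
      | infty => exact absurd h (inv_ne_zero (ofReal_sub_ne_zero hz x))
      | coe y =>
        have h' : ((x : ℂ) - z)⁻¹ = ((y : ℂ) - z)⁻¹ := h
        have : (x : ℂ) = y := by simpa using h'
        rw [Complex.ofReal_inj.1 this]
  have htop := ContinuousMap.starSubalgebra_topologicalClosure_eq_top_of_separatesPoints _ hsep
  have hclosed : IsClosed (multiplierAlgebra W : Set C(OnePoint ℝ, ℂ)) := by
    have : (multiplierAlgebra W : Set C(OnePoint ℝ, ℂ)) =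
        ⋂ v ∈ (weightedPolynomials W).topologicalClosure,
          {φ | restrictToLine φ * v ∈ (weightedPolynomials W).topologicalClosure} := by
      ext φ
      simp only [Set.mem_iInter]
      rfl
    rw [this]
    refine isClosed_biInter fun v _ => ?_
    exact (weightedPolynomials W).isClosed_topologicalClosure.preimage
      (continuous_restrictToLine.mul continuous_const)
  rw [eq_top_iff, ← htop]
  exact StarSubalgebra.topologicalClosure_minimal le_rfl hclosed

theorem polysDense_of_cauchyKernel_mul_mem_closure {W : ℝ → ℝ} (hWpos : ∀ x, 0 < W x)
    {v₀ : BoundedContinuousFunction ℝ ℂ} (hv₀ : ∀ x, v₀ x * W x = 1) (z : ℂ) (hz : z.im ≠ 0)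
    (hmem : cauchyKernel z hz * v₀ ∈ (weightedPolynomials W).topologicalClosure) :
    PolysDense W := by
  rintro f ⟨hfc, hflim⟩ ε hε
  have hev := hflim.eventually (gt_mem_nhds (half_pos hε))
  rw [← Metric.cobounded_eq_cocompact, (hasBasis_cobounded_norm).eventually_iff] at hev
  obtain ⟨R, -, hR⟩ := hev
  let χ : ℝ → ℝ := fun x => max 0 (min 1 (R + 1 - |x|))
  have hχc : Continuous χ := by fun_prop
  have hχ0 (x : ℝ) : 0 ≤ χ x := le_max_left _ _
  have hχ1 (x : ℝ) : χ x ≤ 1 := max_le zero_le_one (min_le_left _ _)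
  have hlim : Tendsto (fun x : ℝ => f x * χ x) (coclosedCompact ℝ) (nhds 0) := by
    rw [coclosedCompact_eq_cocompact, ← Metric.cobounded_eq_cocompact]
    refine tendsto_const_nhds.congr' ?_
    filter_upwards [(hasBasis_cobounded_norm).mem_of_mem (i := R + 1) trivial] with x hx
    have hx : R + 1 ≤ |x| := hx
    have : χ x = 0 := max_eq_left ((min_le_right _ _).trans (by linarith))
    simp [this]
  let φ : C(OnePoint ℝ, ℂ) := OnePoint.continuousMapMk ⟨fun x : ℝ => f x * χ x, by fun_prop⟩ 0 hlim
  have hφ : φ ∈ multiplierAlgebra W := by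
    rw [multiplierAlgebra_eq_top hv₀ z hz hmem]
    trivial
  have hv₀mem : v₀ ∈ (weightedPolynomials W).topologicalClosure :=
    (weightedPolynomials W).le_topologicalClosure ⟨1, by simpa using hv₀⟩
  obtain ⟨v, ⟨P, hP⟩, hv⟩ := Metric.mem_closure_iff.1 (hφ v₀ hv₀mem) (ε / 2) (half_pos hε)
  refine ⟨P, fun x => ?_⟩
  have hWx := hWpos x
  have h1 : ‖f x - f x * χ x‖ ≤ ε / 2 * W x := by
    by_cases hx : R ≤ |x|
    · have h2 : ‖f x‖ / W x < ε / 2 := hR hx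
      rw [div_lt_iff₀ hWx] at h2
      have : f x - f x * χ x = f x * ((1 - χ x : ℝ) : ℂ) := by push_cast; ring
      rw [this, norm_mul, Complex.norm_real, Real.norm_of_nonneg (by linarith [hχ1 x])]
      nlinarith [norm_nonneg (f x), hχ0 x]
    · have : χ x = 1 := by
        simp only [χ]
        rw [min_eq_left (by linarith [not_le.1 hx]), max_eq_right zero_le_one]
      rw [this]
      simp
      positivity
  have h2 : ‖f x * χ x - P.eval (x : ℂ)‖ ≤ ε / 2 * W x := by
    have h3 := (BoundedContinuousFunction.dist_coe_le_dist (f := restrictToLine φ * v₀) (g := v)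
      x).trans hv.le
    rw [dist_eq_norm] at h3
    have h4 : f x * χ x - P.eval (x : ℂ) = ((restrictToLine φ * v₀) x - v x) * W x := by
      rw [sub_mul, hP, BoundedContinuousFunction.mul_apply, mul_assoc, hv₀, mul_one]
      rfl
    rw [h4, norm_mul, Complex.norm_real, Real.norm_of_nonneg hWx.le]
    gcongr
  calc ‖f x - P.eval (x : ℂ)‖ = ‖(f x - f x * χ x) + (f x * χ x - P.eval (x : ℂ))‖ := by
        congr 1; ring
    _ ≤ _ := norm_add_le _ _
    _ ≤ ε * W x := by linarith

/-- The Cauchy transform of an annihilator of the polynomials: if the polynomials are not dense,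
every admissible polynomial is bounded by the reciprocal of a fixed analytic function. -/
theorem exists_annihilator_transform {W : ℝ → ℝ} (hWc : Continuous W) (hWpos : ∀ x, 0 < W x)
    (hW0 : Tendsto (fun x : ℝ => 1 / W x) (cocompact ℝ) (nhds 0)) (hnd : ¬ PolysDense W) :
    ∃ (F : ℂ → ℂ) (M : ℝ), 0 < M ∧ DifferentiableOn ℂ F {z | 0 < z.im} ∧
      (∀ z : ℂ, 1 ≤ z.im → ‖F z‖ ≤ M) ∧ F (2 * Complex.I) ≠ 0 ∧
      ∀ P : Polynomial ℂ, (∀ x : ℝ, ‖P.eval (x : ℂ)‖ ≤ W x) →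
        ∀ z : ℂ, 1 ≤ z.im → ‖P.eval z‖ * ‖F z‖ ≤ M := by
  have hWne (x : ℝ) : (W x : ℂ) ≠ 0 := Complex.ofReal_ne_zero.2 (hWpos x).ne'
  have hdivc (f : ℝ → ℂ) (hf : Continuous f) : Continuous fun x => f x / (W x : ℂ) :=
    hf.div (Complex.continuous_ofReal.comp hWc) hWne
  let v₀' : ZeroAtInftyContinuousMap ℝ ℂ := ⟨⟨fun x => 1 / (W x : ℂ), hdivc _ continuous_const⟩, by
    have := (Complex.continuous_ofReal.tendsto 0).comp hW0
    simpa [Function.comp_def] using this⟩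
  let v₀ : BoundedContinuousFunction ℝ ℂ := v₀'.toBCF
  have hv₀ (x : ℝ) : v₀ x * W x = 1 := div_mul_cancel₀ _ (hWne x)
  have h2 : (2 * Complex.I).im ≠ 0 := by simp
  let g := cauchyKernel (2 * Complex.I) h2
  have hg : g * v₀ ∉ (weightedPolynomials W).topologicalClosure := fun hmem =>
    hnd (polysDense_of_cauchyKernel_mul_mem_closure hWpos hv₀ _ h2 hmem)
  have hcl : IsClosed ((weightedPolynomials W).topologicalClosure : Set (BoundedContinuousFunction ℝ ℂ)) :=
    (weightedPolynomials W).isClosed_topologicalClosure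
  obtain ⟨Λ, hΛg, hΛV⟩ : ∃ Λ : StrongDual ℂ (BoundedContinuousFunction ℝ ℂ),
      Λ (g * v₀) = 1 ∧ ∀ v ∈ weightedPolynomials W, Λ v = 0 := by
    have hq : (weightedPolynomials W).topologicalClosure.mkQ (g * v₀) ≠ 0 := by
      simpa using hg
    obtain ⟨l, hl⟩ := SeparatingDual.exists_eq_one (R := ℂ) hq
    refine ⟨l.comp (weightedPolynomials W).topologicalClosure.mkQL, hl, fun v hv => ?_⟩
    have : (weightedPolynomials W).topologicalClosure.mkQ v = 0 := by
      simpa using (weightedPolynomials W).le_topologicalClosure hv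
    exact (congrArg l this).trans (map_zero l)
  let F : ℂ → ℂ := fun z => Λ (g * Ring.inverse (1 - (z - 2 * Complex.I) • g) * v₀)
  have hmul {z : ℂ} (hz : z.im ≠ 0) :
      (1 - (z - 2 * Complex.I) • g) * (1 + (z - 2 * Complex.I) • cauchyKernel z hz) = 1 := by
    ext t
    have h3 := ofReal_sub_ne_zero hz t
    have h4 := ofReal_sub_ne_zero h2 t
    simp only [g, BoundedContinuousFunction.mul_apply, BoundedContinuousFunction.sub_apply,
      BoundedContinuousFunction.add_apply, BoundedContinuousFunction.smul_apply,
      BoundedContinuousFunction.coe_one, Pi.one_apply, cauchyKernel_apply, smul_eq_mul]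
    field_simp
    ring
  have hunit {z : ℂ} (hz : z.im ≠ 0) : IsUnit (1 - (z - 2 * Complex.I) • g) :=
    IsUnit.of_mul_eq_one _ (hmul hz)
  have hFz {z : ℂ} (hz : z.im ≠ 0) : F z = Λ (cauchyKernel z hz * v₀) := by
    have h3 : Ring.inverse (1 - (z - 2 * Complex.I) • g) =
        1 + (z - 2 * Complex.I) • cauchyKernel z hz := by
      have h := Ring.inverse_mul_cancel_left _ (1 + (z - 2 * Complex.I) • cauchyKernel z hz)
        (hunit hz)
      rwa [hmul hz, mul_one] at h
    have h4 : g * (1 + (z - 2 * Complex.I) • cauchyKernel z hz) = cauchyKernel z hz := by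
      ext t
      have h5 := ofReal_sub_ne_zero hz t
      have h6 := ofReal_sub_ne_zero h2 t
      simp only [g, BoundedContinuousFunction.mul_apply,
        BoundedContinuousFunction.add_apply, BoundedContinuousFunction.smul_apply,
        BoundedContinuousFunction.coe_one, Pi.one_apply, cauchyKernel_apply, smul_eq_mul]
      field_simp
      ring
    simp only [F]
    rw [h3, h4]
  have hker {z : ℂ} (hz : 1 ≤ z.im) (v : BoundedContinuousFunction ℝ ℂ) :
      ‖Λ (cauchyKernel z (by linarith : 0 < z.im).ne' * v)‖ ≤ ‖Λ‖ * ‖v‖ := by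
    refine (Λ.le_opNorm _).trans ?_
    gcongr
    refine (norm_mul_le _ _).trans (mul_le_of_le_one_left (norm_nonneg _) ?_)
    refine (norm_cauchyKernel_le _ _).trans (inv_le_one_of_one_le₀ ?_)
    exact hz.trans (le_abs_self _)
  have hΛ := norm_nonneg Λ
  have hv₀n := norm_nonneg v₀
  refine ⟨F, ‖Λ‖ * (1 + ‖v₀‖) + 1, by positivity, ?_, ?_, ?_, ?_⟩
  · intro z hz
    have hz' : z.im ≠ 0 := ne_of_gt hz
    have h3 : DifferentiableAt ℂ (fun z : ℂ => 1 - (z - 2 * Complex.I) • g) z := by fun_prop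
    have h4 := (differentiableAt_inverse (𝕜 := ℂ) (hunit hz')).comp z h3
    have h5 : DifferentiableAt ℂ
        (fun z : ℂ => g * Ring.inverse (1 - (z - 2 * Complex.I) • g) * v₀) z :=
      (DifferentiableAt.const_mul h4 g).mul_const v₀
    exact (Λ.differentiableAt.comp z h5).differentiableWithinAt
  · intro z hz
    rw [hFz (by linarith : 0 < z.im).ne']
    exact (hker hz v₀).trans (by nlinarith)
  · rw [hFz h2, hΛg]
    exact one_ne_zero
  · intro P hP z hz
    let v : BoundedContinuousFunction ℝ ℂ := BoundedContinuousFunction.ofNormedAddCommGroup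
      (fun x : ℝ => P.eval (x : ℂ) / (W x : ℂ)) (hdivc _ (by fun_prop)) 1 (fun x => by
        rw [norm_div, Complex.norm_real, Real.norm_of_nonneg (hWpos x).le]
        exact div_le_one_of_le₀ (hP x) (hWpos x).le)
    have hv (x : ℝ) : v x * W x = P.eval (x : ℂ) := div_mul_cancel₀ _ (hWne x)
    have hvn : ‖v‖ ≤ 1 :=
      BoundedContinuousFunction.norm_ofNormedAddCommGroup_le _ zero_le_one _
    have hz' : z.im ≠ 0 := (by linarith : 0 < z.im).ne'
    have h3 := hΛV _ (cauchyKernel_mul_sub_mem hv hv₀ z hz')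
    rw [map_sub, map_smul, sub_eq_zero, smul_eq_mul, ← hFz hz'] at h3
    rw [← norm_mul, ← h3]
    refine (hker hz v).trans ?_
    nlinarith

theorem ofReal_log_norm_eval_sub_le (P : Polynomial ℂ) (a b : ℂ) :
    ENNReal.ofReal (2 * Real.pi * Real.log ‖P.eval (a - b * Complex.I)‖) ≤
      ∫⁻ t : ℝ, cauchyWeight t * ENNReal.ofReal (Real.log ‖P.eval (a - b * t)‖) := by
  have h (z : ℂ) : (P.comp (C a - C b * X)).eval z = P.eval (a - b * z) := by simp
  generalize P.comp (C a - C b * X) = Q at h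
  simpa only [h] using ofReal_log_norm_eval_I_le Q

theorem ofReal_log_norm_eval_add_le (P : Polynomial ℂ) (a b : ℂ) :
    ENNReal.ofReal (2 * Real.pi * Real.log ‖P.eval (a + b * Complex.I)‖) ≤
      ∫⁻ t : ℝ, cauchyWeight t * ENNReal.ofReal (Real.log ‖P.eval (a - b * t)‖) := by
  have h := ofReal_log_norm_eval_sub_le P a (-b)
  rw [← lintegral_neg_eq_self] at h
  simpa [cauchyWeight] using h

theorem ofReal_log_le_ofReal_two_pi_mul_log (x : ℝ) :
    ENNReal.ofReal (Real.log x) ≤ ENNReal.ofReal (2 * Real.pi * Real.log x) := by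
  rcases le_total (Real.log x) 0 with h | h
  · simp [ENNReal.ofReal_of_nonpos h]
  · exact ENNReal.ofReal_le_ofReal (le_mul_of_one_le_left h (by linarith [Real.pi_gt_three]))

/-- A polynomial is controlled near the origin by its logarithmic integral over the line. -/
theorem ofReal_log_norm_eval_le (P : Polynomial ℂ) {z : ℂ} (hre : |z.re| ≤ 1 / 2)
    (him : |z.im| ≤ 1 / 2) :
    ENNReal.ofReal (Real.log ‖P.eval z‖) ≤ 9 * (4 * (∫⁻ t, cauchyWeight t) *
      ∫⁻ t : ℝ, cauchyWeight t * ENNReal.ofReal (Real.log ‖P.eval (t : ℂ)‖)) := by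
  have hb := abs_le.1 him
  have hmeas : Measurable fun t : ℝ => ENNReal.ofReal (Real.log ‖P.eval (t : ℂ)‖) := by
    have : Continuous fun t : ℝ => P.eval (t : ℂ) := by fun_prop
    exact ENNReal.measurable_ofReal.comp (Real.measurable_log.comp this.norm.measurable)
  have hpt : ((z.re : ℂ) + Complex.I) - ((1 - z.im : ℝ) : ℂ) * Complex.I = z := by
    apply Complex.ext <;> simp
  have h1 := ofReal_log_norm_eval_sub_le P ((z.re : ℂ) + Complex.I) ((1 - z.im : ℝ) : ℂ)
  rw [hpt] at h1
  refine (ofReal_log_le_ofReal_two_pi_mul_log _).trans (h1.trans ?_)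
  calc ∫⁻ t : ℝ, cauchyWeight t * ENNReal.ofReal
        (Real.log ‖P.eval ((z.re : ℂ) + Complex.I - ((1 - z.im : ℝ) : ℂ) * t)‖)
      = ∫⁻ t : ℝ, cauchyWeight t * (fun s : ℝ => ENNReal.ofReal
          (Real.log ‖P.eval ((s : ℂ) + Complex.I)‖)) (z.re - (1 - z.im) * t) := by
        refine lintegral_congr fun t => ?_
        congr 5
        push_cast
        ring
    _ ≤ 9 * ∫⁻ s : ℝ, cauchyWeight s *
          ENNReal.ofReal (Real.log ‖P.eval ((s : ℂ) + Complex.I)‖) :=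
        lintegral_cauchyWeight_comp_le hre (by linarith) (by linarith)
    _ ≤ 9 * ∫⁻ s : ℝ, cauchyWeight s * ∫⁻ t : ℝ, cauchyWeight t *
          ENNReal.ofReal (Real.log ‖P.eval ((s - t : ℝ) : ℂ)‖) := by
        gcongr with s
        refine (ofReal_log_le_ofReal_two_pi_mul_log _).trans ?_
        simpa using ofReal_log_norm_eval_add_le P s 1
    _ ≤ _ := by
        gcongr
        exact lintegral_cauchyWeight_conv_le hmeas

theorem cauchyWeight_mul_ofReal (x y : ℝ) :
    cauchyWeight x * ENNReal.ofReal y = 2 * ENNReal.ofReal (y / (1 + x ^ 2)) := by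
  rw [cauchyWeight, ← ENNReal.ofReal_mul (by positivity), ← ENNReal.ofReal_ofNat,
    ← ENNReal.ofReal_mul (by positivity)]
  congr 1
  ring

theorem ofReal_log_le_ofReal_log {x y : ℝ} (hx : 0 ≤ x) (hxy : x ≤ y) :
    ENNReal.ofReal (Real.log x) ≤ ENNReal.ofReal (Real.log y) := by
  rcases hx.eq_or_lt with rfl | hx
  · simp
  · exact ENNReal.ofReal_le_ofReal (Real.log_le_log hx hxy)

theorem hallMajorant_ofReal_ne_top (W : ℝ → ℝ) (x : ℝ) : hallMajorant W x ≠ ⊤ := by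
  refine ne_top_of_le_ne_top ENNReal.ofReal_ne_top (b := ENNReal.ofReal (W x))
    (iSup_le fun P => ?_)
  rw [← ENNReal.ofReal_coe_nnreal, coe_nnnorm]
  exact ENNReal.ofReal_le_ofReal (P.2 x)

theorem norm_eval_le_hallMajorant {W : ℝ → ℝ} {P : Polynomial ℂ}
    (hP : ∀ x : ℝ, ‖P.eval (x : ℂ)‖ ≤ W x) (x : ℝ) :
    ‖P.eval (x : ℂ)‖ ≤ (hallMajorant W x).toReal := by
  have h : (‖P.eval (x : ℂ)‖₊ : ℝ≥0∞) ≤ hallMajorant W x :=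
    le_iSup (fun P : {P : Polynomial ℂ // ∀ x : ℝ, ‖P.eval (x : ℂ)‖ ≤ W x} =>
      (‖(P : Polynomial ℂ).eval (x : ℂ)‖₊ : ℝ≥0∞)) ⟨P, hP⟩
  simpa using ENNReal.toReal_mono (hallMajorant_ofReal_ne_top W x) h

theorem exists_norm_eval_le_of_lintegral_ne_top {W : ℝ → ℝ}
    (hfin : ∫⁻ x : ℝ, cauchyWeight x *
      ENNReal.ofReal (Real.log (hallMajorant W x).toReal) ≠ ⊤) :
    ∃ B : ℝ, 0 < B ∧ ∀ (P : Polynomial ℂ) (c : ℝ), 0 < c →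
      (∀ x : ℝ, ‖P.eval (x : ℂ)‖ ≤ c * W x) →
      ∀ z ∈ Metric.ball (0 : ℂ) (1 / 2), ‖P.eval z‖ ≤ c * B := by
  set J := 9 * (4 * (∫⁻ t, cauchyWeight t) * ∫⁻ x : ℝ, cauchyWeight x *
      ENNReal.ofReal (Real.log (hallMajorant W x).toReal)) with hJ
  have hJtop : J ≠ ⊤ := ENNReal.mul_ne_top (by simp)
    (ENNReal.mul_ne_top (ENNReal.mul_ne_top (by simp) lintegral_cauchyWeight_ne_top) hfin)
  refine ⟨Real.exp J.toReal, Real.exp_pos _, fun P c hc hP z hz => ?_⟩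
  have hz' : ‖z‖ < 1 / 2 := by simpa using hz
  have key (Q : Polynomial ℂ) (hQ : ∀ x : ℝ, ‖Q.eval (x : ℂ)‖ ≤ W x) :
      ‖Q.eval z‖ ≤ Real.exp J.toReal := by
    have h : ENNReal.ofReal (Real.log ‖Q.eval z‖) ≤ J := by
      refine (ofReal_log_norm_eval_le Q ((Complex.abs_re_le_norm z).trans hz'.le)
        ((Complex.abs_im_le_norm z).trans hz'.le)).trans ?_
      rw [hJ]
      refine mul_le_mul' le_rfl (mul_le_mul' le_rfl (lintegral_mono fun t => ?_))
      exact mul_le_mul' le_rfl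
        (ofReal_log_le_ofReal_log (norm_nonneg _) (norm_eval_le_hallMajorant hQ t))
    exact Real.le_exp_of_log_le ((ENNReal.ofReal_le_iff_le_toReal hJtop).1 h)
  have h := key (C (c : ℂ)⁻¹ * P) (fun x => by
    rw [eval_mul, eval_C, norm_mul, norm_inv, Complex.norm_real, Real.norm_of_nonneg hc.le,
      inv_mul_le_iff₀ hc]
    exact hP x)
  rwa [eval_mul, eval_C, norm_mul, norm_inv, Complex.norm_real, Real.norm_of_nonneg hc.le,
      inv_mul_le_iff₀ hc] at h

theorem not_polysDense_of_lintegral_ne_top {W : ℝ → ℝ}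
    (hW1 : Tendsto (fun x : ℝ => x / W x) (cocompact ℝ) (nhds 0)) (hWpos : ∀ x, 0 < W x)
    (hfin : ∫⁻ x : ℝ, cauchyWeight x *
      ENNReal.ofReal (Real.log (hallMajorant W x).toReal) ≠ ⊤) : ¬ PolysDense W := by
  intro hd
  obtain ⟨B, hB, hBound⟩ := exists_norm_eval_le_of_lintegral_ne_top hfin
  have hmem : MemC0 W (fun x => ((|x| : ℝ) : ℂ)) := by
    refine ⟨by fun_prop, ?_⟩
    have := hW1.norm
    simpa [abs_div, abs_of_pos (hWpos _)] using this
  let ε : ℕ → ℝ := fun n => 1 / (n + 1 : ℝ)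
  have hε (n : ℕ) : 0 < ε n := by positivity
  have hεlim : Tendsto ε atTop (nhds 0) := tendsto_one_div_add_atTop_nhds_zero_nat
  choose P hP using fun n => hd _ hmem (ε n) (hε n)
  have hdiff (m n : ℕ) (z : ℂ) (hz : z ∈ Metric.ball (0 : ℂ) (1 / 2)) :
      ‖(P m).eval z - (P n).eval z‖ ≤ (ε m + ε n) * B := by
    have := hBound (P m - P n) (ε m + ε n) (add_pos (hε m) (hε n)) (fun x => ?_) z hz
    · simpa using this
    · have h1 := norm_sub_le_norm_sub_add_norm_sub ((P m).eval (x : ℂ)) ((|x| : ℝ) : ℂ)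
        ((P n).eval (x : ℂ))
      rw [norm_sub_rev ((P m).eval (x : ℂ)) ((|x| : ℝ) : ℂ)] at h1
      rw [Polynomial.eval_sub, add_mul]
      exact h1.trans (add_le_add (hP m x) (hP n x))
  have hcauchy : UniformCauchySeqOn (fun n z => (P n).eval z) atTop
      (Metric.ball (0 : ℂ) (1 / 2)) := by
    rw [Metric.uniformCauchySeqOn_iff]
    intro δ hδ
    have hlim : Tendsto (fun n => ε n * B) atTop (nhds 0) := by
      simpa using hεlim.mul_const B
    obtain ⟨N, hN⟩ := eventually_atTop.1 (hlim.eventually (gt_mem_nhds (half_pos hδ)))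
    refine ⟨N, fun m hm n hn z hz => ?_⟩
    rw [dist_eq_norm]
    have := hdiff m n z hz
    linarith [hN m hm, hN n hn]
  have hex (z : ℂ) (hz : z ∈ Metric.ball (0 : ℂ) (1 / 2)) :
      ∃ w, Tendsto (fun n => (P n).eval z) atTop (nhds w) :=
    cauchySeq_tendsto_of_complete (hcauchy.cauchySeq hz)
  choose! G hG using hex
  have hunif := hcauchy.tendstoUniformlyOn_of_tendsto hG
  have hGd : DifferentiableOn ℂ G (Metric.ball (0 : ℂ) (1 / 2)) :=
    hunif.tendstoLocallyUniformlyOn.differentiableOn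
      (Eventually.of_forall fun n => (P n).differentiable.differentiableOn) Metric.isOpen_ball
  have hGabs (x : ℝ) (hx : (x : ℂ) ∈ Metric.ball (0 : ℂ) (1 / 2)) : G x = ((|x| : ℝ) : ℂ) := by
    refine tendsto_nhds_unique (hG x hx) ?_
    rw [tendsto_iff_norm_sub_tendsto_zero]
    refine squeeze_zero (fun _ => norm_nonneg _) (fun n => ?_)
      (by simpa using hεlim.mul_const (W x))
    rw [norm_sub_rev]
    exact hP n x
  have hG0 : DifferentiableAt ℂ G ((0 : ℝ) : ℂ) :=
    hGd.differentiableAt (Metric.isOpen_ball.mem_nhds (by simp))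
  have hre : DifferentiableAt ℝ (fun x : ℝ => (G x).re) 0 :=
    hG0.hasDerivAt.real_of_complex.differentiableAt
  refine not_differentiableAt_abs_zero (hre.congr_of_eventuallyEq ?_)
  filter_upwards [Metric.ball_mem_nhds (0 : ℝ) (by norm_num : (0 : ℝ) < 1 / 2)] with x hx
  rw [hGabs x (by simpa using hx), Complex.ofReal_re]

theorem ae_comp_add_I_ne_zero {F : ℂ → ℂ} (hF : DifferentiableOn ℂ F {z | 0 < z.im})
    (hF0 : F (2 * Complex.I) ≠ 0) : ∀ᵐ s : ℝ, F (s + Complex.I) ≠ 0 := by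
  have hopen : IsOpen {z : ℂ | 0 < z.im} := isOpen_lt continuous_const Complex.continuous_im
  have han : AnalyticOnNhd ℂ F {z | 0 < z.im} := hF.analyticOnNhd hopen
  have hconn : IsPreconnected {z : ℂ | 0 < z.im} := (convex_halfSpace_im_gt 0).isPreconnected
  have hk : AnalyticOnNhd ℝ (fun s : ℝ => F (s + Complex.I)) Set.univ := by
    intro s _
    have h1 : AnalyticAt ℝ F ((s : ℂ) + Complex.I) := (han _ (by simp)).restrictScalars
    have h2 : AnalyticAt ℝ (fun s : ℝ => (s : ℂ) + Complex.I) s :=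
      (Complex.ofRealCLM.analyticAt s).add analyticAt_const
    exact h1.comp_of_eq h2 rfl
  have hex : ∃ s : ℝ, F (s + Complex.I) ≠ 0 := by
    by_contra! hzero
    refine hF0 (han.eqOn_zero_of_preconnected_of_frequently_eq_zero hconn
      (z₀ := Complex.I) (by simp) ?_ (by simp))
    have htend : Tendsto (fun s : ℝ => (s : ℂ) + Complex.I) (nhdsWithin 0 {0}ᶜ)
        (nhdsWithin Complex.I {Complex.I}ᶜ) := by
      refine tendsto_nhdsWithin_iff.2 ⟨?_, ?_⟩
      · have : Continuous fun s : ℝ => (s : ℂ) + Complex.I := by fun_prop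
        simpa using (this.tendsto 0).mono_left nhdsWithin_le_nhds
      · filter_upwards [self_mem_nhdsWithin] with s hs
        simpa using hs
    exact htend.frequently (Eventually.frequently (Eventually.of_forall hzero))
  obtain ⟨s, hs⟩ := hex
  have hcod := hk.preimage_zero_mem_codiscrete hs
  have := ae_restrict_le_codiscreteWithin (μ := (volume : Measure ℝ)) MeasurableSet.univ hcod
  rw [Measure.restrict_univ] at this
  exact this

theorem lintegral_ne_top_of_not_polysDense {W : ℝ → ℝ} (hWc : Continuous W)
    (hWpos : ∀ x, 0 < W x) (hW0 : Tendsto (fun x : ℝ => 1 / W x) (cocompact ℝ) (nhds 0))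
    (hnd : ¬ PolysDense W) :
    ∫⁻ x : ℝ, cauchyWeight x * ENNReal.ofReal (Real.log (hallMajorant W x).toReal) ≠ ⊤ := by
  obtain ⟨F, M, hM, hFd, hFle, hF0, hPF⟩ := exists_annihilator_transform hWc hWpos hW0 hnd
  let h : ℝ → ℝ≥0∞ := fun s => ENNReal.ofReal (-Real.log (‖F (s + Complex.I)‖ / M))
  have hFc : Continuous fun s : ℝ => F (s + Complex.I) :=
    hFd.continuousOn.comp_continuous (by fun_prop) (fun s => by simp)
  have hmeas : Measurable h := ENNReal.measurable_ofReal.comp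
    (Real.measurable_log.comp (hFc.norm.div_const M).measurable).neg
  have hae := ae_comp_add_I_ne_zero hFd hF0
  have hpoint (P : Polynomial ℂ) (hP : ∀ x : ℝ, ‖P.eval (x : ℂ)‖ ≤ W x) (x : ℝ) :
      ENNReal.ofReal (Real.log ‖P.eval (x : ℂ)‖) ≤ ∫⁻ t, cauchyWeight t * h (x - t) := by
    have h1 := ofReal_log_norm_eval_sub_le P ((x : ℂ) + Complex.I) 1
    rw [one_mul, add_sub_cancel_right] at h1
    refine (ofReal_log_le_ofReal_two_pi_mul_log _).trans (h1.trans (lintegral_mono_ae ?_))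
    have hae' : ∀ᵐ t : ℝ, F ((x - t : ℝ) + Complex.I) ≠ 0 :=
      (quasiMeasurePreserving_sub_left volume x).ae hae
    filter_upwards [hae'] with t ht
    gcongr
    have h2 : (x : ℂ) + Complex.I - 1 * t = ((x - t : ℝ) : ℂ) + Complex.I := by
      push_cast
      ring
    simp only [h]
    rw [h2, ← Real.log_inv, inv_div]
    refine ofReal_log_le_ofReal_log (norm_nonneg _) ?_
    rw [le_div_iff₀ (norm_pos_iff.2 ht)]
    exact hPF P hP _ (by simp)
  have hhall (x : ℝ) : ENNReal.ofReal (Real.log (hallMajorant W x).toReal) ≤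
      ∫⁻ t, cauchyWeight t * h (x - t) := by
    by_cases htop : ∫⁻ t, cauchyWeight t * h (x - t) = ⊤
    · simp [htop]
    set H := ∫⁻ t, cauchyWeight t * h (x - t)
    have h1 : hallMajorant W x ≤ ENNReal.ofReal (Real.exp H.toReal) := by
      refine iSup_le fun P => ?_
      rw [← ENNReal.ofReal_coe_nnreal, coe_nnnorm]
      refine ENNReal.ofReal_le_ofReal (Real.le_exp_of_log_le ?_)
      exact (ENNReal.ofReal_le_iff_le_toReal htop).1 (hpoint P P.2 x)
    have h2 := ENNReal.toReal_le_of_le_ofReal (Real.exp_pos _).le h1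
    refine (ofReal_log_le_ofReal_log ENNReal.toReal_nonneg h2).trans ?_
    rw [Real.log_exp]
    exact ENNReal.ofReal_toReal_le
  refine ne_top_of_le_ne_top ?_ (lintegral_mono fun x => mul_le_mul_right (hhall x) _)
  refine ne_top_of_le_ne_top ?_ (lintegral_cauchyWeight_conv_le hmeas)
  refine ENNReal.mul_ne_top (ENNReal.mul_ne_top (by simp) lintegral_cauchyWeight_ne_top) ?_
  exact ne_top_of_le_ne_top ENNReal.ofReal_ne_top
    (lintegral_neg_log_norm_halfPlane_le hM hFd hFle hF0)

/-- Akhiezer's criterion: the polynomials are dense in `C₀(W)` if and only if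
`∫_ℝ log 𝔪(x)/(1+x²) dx = ∞`.  (On the real axis `𝔪(x) ≤ W(x)` is finite, and
`𝔪(x) ≥ min W > 0`, so the divergence of the integral is expressed via the
Lebesgue integral of the positive part.) -/
theorem stmt1 (W : ℝ → ℝ) (hWc : Continuous W) (hWpos : ∀ x, 0 < W x)
    (hWgrow : ∀ n : ℕ, Tendsto (fun x : ℝ => x ^ n / W x) (cocompact ℝ) (nhds 0)) :
    PolysDense W ↔
      ∫⁻ x : ℝ, ENNReal.ofReal (Real.log ((hallMajorant W (x : ℂ)).toReal) / (1 + x ^ 2)) = ⊤ := by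
  have hint : ∫⁻ x : ℝ, cauchyWeight x * ENNReal.ofReal (Real.log (hallMajorant W x).toReal) =
      2 * ∫⁻ x : ℝ,
        ENNReal.ofReal (Real.log ((hallMajorant W (x : ℂ)).toReal) / (1 + x ^ 2)) := by
    rw [← lintegral_const_mul' _ _ (by simp)]
    exact lintegral_congr fun x => cauchyWeight_mul_ofReal _ _
  have hiff : ∫⁻ x : ℝ, ENNReal.ofReal
        (Real.log ((hallMajorant W (x : ℂ)).toReal) / (1 + x ^ 2)) = ⊤ ↔
      ∫⁻ x : ℝ, cauchyWeight x * ENNReal.ofReal (Real.log (hallMajorant W x).toReal) = ⊤ := by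
    rw [hint]
    simp [ENNReal.mul_eq_top]
  rw [hiff]
  constructor
  · intro hd
    by_contra hfin
    exact not_polysDense_of_lintegral_ne_top (by simpa using hWgrow 1) hWpos hfin hd
  · intro htop
    by_contra hnd
    exact lintegral_ne_top_of_not_polysDense hWc hWpos (by simpa using hWgrow 0) hnd htop
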